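/- In R = k[[x, y, z, w, s, t]] one has Ω^{[p]} : Ω = (G_1^p, x^p, w^p, (G_1 x w)^{p−1}), and moreover this ideal equals Ω^{[p]} + ((G_3 G_2)^{p−1}); in particular, the classes of (G_1 x w)^{p−1} and of (G_3 G_2)^{p−1} both generate the cyclic module (Ω^{[p]} : Ω)/Ω^{[p]}. -/

import Mathlib

/-- `𝔞^{[q]}`: the ideal generated by the `q`-th powers of all elements of `𝔞`. -/
def frobPow {R : Type} [CommRing R] (q : ℕ) (a : Ideal R) : Ideal R :=
  Ideal.span ((fun x => x ^ q) '' (a : Set R))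

/- `R = k[[x, y, z, w, s, t]]`, with the six variables indexed by `Fin 6` in the order
`x, y, z, w, s, t`. -/
noncomputable def px (k : Type) [Field k] : MvPowerSeries (Fin 6) k := MvPowerSeries.X 0
noncomputable def py (k : Type) [Field k] : MvPowerSeries (Fin 6) k := MvPowerSeries.X 1
noncomputable def pz (k : Type) [Field k] : MvPowerSeries (Fin 6) k := MvPowerSeries.X 2
noncomputable def pw (k : Type) [Field k] : MvPowerSeries (Fin 6) k := MvPowerSeries.X 3
noncomputable def ps (k : Type) [Field k] : MvPowerSeries (Fin 6) k := MvPowerSeries.X 4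
noncomputable def pt (k : Type) [Field k] : MvPowerSeries (Fin 6) k := MvPowerSeries.X 5

/-- `G₁ = yt - zs`. -/
noncomputable def G1 (k : Type) [Field k] : MvPowerSeries (Fin 6) k := py k * pt k - pz k * ps k
/-- `G₂ = xt - zw`. -/
noncomputable def G2 (k : Type) [Field k] : MvPowerSeries (Fin 6) k := px k * pt k - pz k * pw k
/-- `G₃ = xs - yw`. -/
noncomputable def G3 (k : Type) [Field k] : MvPowerSeries (Fin 6) k := px k * ps k - py k * pw k

/-- `I = I₂(X) = (G₁, G₂, G₃)`, the ideal of `2 × 2` minors of the `3 × 2` matrix `X` with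
rows `(x, w), (y, s), (z, t)`. -/
noncomputable def I32 (k : Type) [Field k] : Ideal (MvPowerSeries (Fin 6) k) :=
  Ideal.span {G1 k, G2 k, G3 k}

/-- `P = (x, w)`. -/
noncomputable def P32 (k : Type) [Field k] : Ideal (MvPowerSeries (Fin 6) k) :=
  Ideal.span {px k, pw k}

/-- `Ω = I + P`. -/
noncomputable def Om32 (k : Type) [Field k] : Ideal (MvPowerSeries (Fin 6) k) :=
  I32 k ⊔ P32 k

section CommRing

variable {R : Type*} [CommRing R]

/-- In a domain of characteristic `p`, `(a - b)^(p-1) = ∑ a^i b^(p-1-i)`. -/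
theorem sub_pow_pred_char [IsDomain R] {n : ℕ} (hp : (n + 1).Prime) [CharP R (n + 1)] (a b : R) :
    (a - b) ^ n = ∑ i ∈ Finset.range (n + 1), a ^ i * b ^ (n - i) := by
  have : Fact (n + 1).Prime := ⟨hp⟩
  rcases eq_or_ne a b with rfl | hab
  · have hn : n ≠ 0 := by
      rintro rfl
      exact Nat.not_prime_one hp
    have h : ∀ i ∈ Finset.range (n + 1), a ^ i * a ^ (n - i) = a ^ n := fun i hi => by
      rw [← pow_add, Nat.add_sub_cancel' (Nat.lt_succ_iff.mp (Finset.mem_range.mp hi))]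
    rw [Finset.sum_congr rfl h, Finset.sum_const, Finset.card_range, nsmul_eq_mul,
      CharP.cast_eq_zero, zero_mul, sub_self, zero_pow hn]
  · refine mul_left_cancel₀ (sub_ne_zero.mpr hab) ?_
    rw [← pow_succ', sub_pow_char, ← (Commute.all a b).mul_geom_sum₂ (n + 1)]
    simp

theorem sub_pow_pred_char' [IsDomain R] {n : ℕ} (hp : (n + 1).Prime) [CharP R (n + 1)] (a b : R) :
    (a - b) ^ n = ∑ i ∈ Finset.range (n + 1), b ^ i * a ^ (n - i) := by
  rw [sub_pow_pred_char hp, ← Finset.sum_range_reflect]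
  refine Finset.sum_congr rfl fun i hi => ?_
  have := Finset.mem_range.mp hi
  rw [show n + 1 - 1 - i = n - i by omega, show n - (n - i) = i by omega, mul_comm]

/-- Modulo `(x^p, w^p)`, the `(p-1)`-st powers of `(xs - yw)(xt - zw)` and `(yt - zs)xw` agree. -/
theorem minors_pow_sub_mem [IsDomain R] {n : ℕ} (hp : (n + 1).Prime) [CharP R (n + 1)]
    (x y z w s t : R) :
    ((x * s - y * w) * (x * t - z * w)) ^ n - ((y * t - z * s) * x * w) ^ n ∈
      Ideal.span {x ^ (n + 1), w ^ (n + 1)} := by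
  rw [← Ideal.Quotient.eq, mul_pow, sub_pow_pred_char hp, sub_pow_pred_char' hp, mul_assoc,
    mul_pow (y * t - z * s), sub_pow_pred_char' hp, Finset.sum_mul_sum, Finset.sum_mul]
  simp only [map_sum]
  refine Finset.sum_congr rfl fun i hi => ?_
  have hi := Finset.mem_range.mp hi
  rw [Finset.sum_eq_single i]
  · congr 1
    obtain ⟨m, rfl⟩ : ∃ m, n = i + m := Nat.exists_eq_add_of_le (by omega)
    rw [Nat.add_sub_cancel_left]
    ring
  · intro j hj hji
    have hj := Finset.mem_range.mp hj
    rw [Ideal.Quotient.eq_zero_iff_mem]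
    rcases lt_or_gt_of_ne hji with h | h
    · refine Ideal.mem_of_dvd _ ?_ (Ideal.subset_span (Set.mem_insert _ _))
      have : x ^ (n + 1) ∣ x ^ i * x ^ (n - j) := by
        rw [← pow_add]
        exact pow_dvd_pow _ (by omega)
      refine this.trans ⟨s ^ i * (y * w) ^ (n - i) * ((z * w) ^ j * t ^ (n - j)), ?_⟩
      ring
    · refine Ideal.mem_of_dvd _ ?_ (Ideal.subset_span (Set.mem_insert_of_mem _ rfl))
      have : w ^ (n + 1) ∣ w ^ (n - i) * w ^ j := by
        rw [← pow_add]
        exact pow_dvd_pow _ (by omega)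
      refine this.trans ⟨(x * s) ^ i * y ^ (n - i) * (z ^ j * (x * t) ^ (n - j)), ?_⟩
      ring
  · exact fun h => absurd (Finset.mem_range.mpr hi) h

/-- An element that is a non-zero-divisor modulo `(u, v)` has the same property for its powers. -/
theorem pow_cancel_mod_pair {x u v : R}
    (h : ∀ f a b, x * f = a * u + b * v → ∃ a' b', f = a' * u + b' * v) (n : ℕ) :
    ∀ f a b, x ^ n * f = a * u + b * v → ∃ a' b', f = a' * u + b' * v := by
  induction n with
  | zero => exact fun f a b hf => ⟨a, b, by simpa using hf⟩
  | succ n ih =>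
    intro f a b hf
    obtain ⟨a', b', h'⟩ := h (x ^ n * f) a b (by rw [← hf]; ring)
    exact ih f a' b' h'

/-- The colon ideal `(x^{n+1}, w^{n+1}, c^{n+1}) : (x, w, c)`, for `x, w, c` satisfying the
regularity conditions needed. -/
theorem mem_of_mul_mem_powers {x w c : R} {n : ℕ}
    (hx : ∀ f a b, x * f = a * w ^ (n + 1) + b * c ^ (n + 1) →
      ∃ a' b', f = a' * w ^ (n + 1) + b' * c ^ (n + 1))
    (hw : ∀ f a b, w * f = a * x + b * c ^ (n + 1) → ∃ a' b', f = a' * x + b' * c ^ (n + 1))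
    (hc : ∀ f a b, c * f = a * x + b * w → ∃ a' b', f = a' * x + b' * w) {r : R}
    (h₁ : r * x ∈ Ideal.span {c ^ (n + 1), x ^ (n + 1), w ^ (n + 1)})
    (h₂ : r * w ∈ Ideal.span {c ^ (n + 1), x ^ (n + 1), w ^ (n + 1)})
    (h₃ : r * c ∈ Ideal.span {c ^ (n + 1), x ^ (n + 1), w ^ (n + 1)}) :
    r ∈ Ideal.span {c ^ (n + 1), x ^ (n + 1), w ^ (n + 1), (c * x * w) ^ n} := by
  obtain ⟨d₁, a₁, b₁, e₁⟩ := Submodule.mem_span_triple.mp h₁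
  obtain ⟨d₂, a₂, b₂, e₂⟩ := Submodule.mem_span_triple.mp h₂
  obtain ⟨d₃, a₃, b₃, e₃⟩ := Submodule.mem_span_triple.mp h₃
  simp only [smul_eq_mul] at e₁ e₂ e₃
  obtain ⟨b, d, f₁⟩ := hx (r - a₁ * x ^ n) b₁ d₁ (by linear_combination -e₁)
  obtain ⟨b', d', f₂⟩ := pow_cancel_mod_pair hx n (a₁ * w - a₂ * x) (b₂ - b * w) (d₂ - d * w)
    (by linear_combination -e₂ - w * f₁)
  obtain ⟨a'', d'', f₃⟩ := hw (a₁ - b' * w ^ n) a₂ d' (by linear_combination f₂)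
  obtain ⟨b₄, d₄, f₄⟩ := pow_cancel_mod_pair hx n (b' * w ^ n * c - (a₃ - a'' * c) * x)
    (b₃ - b * c) (d₃ - d * c - d'' * x ^ n * c)
    (by linear_combination -e₃ - c * f₁ - c * x ^ n * f₃)
  obtain ⟨a₅, d₅, f₅⟩ := pow_cancel_mod_pair hw n (b' * c - b₄ * w) (a₃ - a'' * c) d₄
    (by linear_combination f₄)
  obtain ⟨a₆, b₆, f₆⟩ := hc (b' - d₅ * c ^ n) a₅ b₄ (by linear_combination f₅)
  have key : r = (d + d'' * x ^ n) * c ^ (n + 1) + ((a'' + a₆ * w ^ n) * x ^ (n + 1) +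
      ((b + b₆ * x ^ n) * w ^ (n + 1) + d₅ * (c * x * w) ^ n)) := by
    linear_combination f₁ + x ^ n * f₃ + x ^ n * w ^ n * f₆
  rw [key]
  refine add_mem (Ideal.mul_mem_left _ _ (Ideal.subset_span (by simp)))
    (add_mem (Ideal.mul_mem_left _ _ (Ideal.subset_span (by simp)))
      (add_mem (Ideal.mul_mem_left _ _ (Ideal.subset_span (by simp)))
        (Ideal.mul_mem_left _ _ (Ideal.subset_span (by simp)))))

end CommRing

theorem frobPow_span_triple {R : Type} [CommRing R] {p : ℕ} (hp : p.Prime) [CharP R p]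
    (a b c : R) : frobPow p (Ideal.span {a, b, c}) = Ideal.span {a ^ p, b ^ p, c ^ p} := by
  have : Fact p.Prime := ⟨hp⟩
  refine le_antisymm (Ideal.span_le.mpr ?_) (Ideal.span_le.mpr ?_)
  · rintro _ ⟨f, hf, rfl⟩
    obtain ⟨u, v, w, rfl⟩ := Submodule.mem_span_triple.mp hf
    refine Submodule.mem_span_triple.mpr ⟨u ^ p, v ^ p, w ^ p, ?_⟩
    simp only [smul_eq_mul, add_pow_char, mul_pow]
  · rintro _ (rfl | rfl | rfl) <;>
      exact Ideal.subset_span ⟨_, Ideal.subset_span (by simp), rfl⟩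

namespace MvPowerSeries

variable {σ k : Type*} [CommRing k]

/-- The quotient of a power series by `X i`, discarding the monomials not divisible by `X i`. -/
noncomputable def divX (i : σ) : MvPowerSeries σ k →+ MvPowerSeries σ k where
  toFun f := fun m => coeff (m + Finsupp.single i 1) f
  map_zero' := rfl
  map_add' _ _ := rfl

theorem coeff_divX (i : σ) (f : MvPowerSeries σ k) (m : σ →₀ ℕ) :
    coeff m (divX i f) = coeff (m + Finsupp.single i 1) f := rfl

theorem divX_X_mul (i : σ) (f : MvPowerSeries σ k) : divX i (X i * f) = f := by
  ext m
  rw [coeff_divX, add_comm, X, coeff_add_monomial_mul, one_mul]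

/-- `g` commutes with `divX i`, as happens when `g` does not involve `X i`. -/
def IsFree (i : σ) (g : MvPowerSeries σ k) : Prop := ∀ f, divX i (g * f) = g * divX i f

theorem isFree_X {i j : σ} (h : j ≠ i) : IsFree i (X j : MvPowerSeries σ k) := by
  classical
  intro f
  ext m
  rw [coeff_divX, X, coeff_monomial_mul, coeff_monomial_mul, coeff_divX]
  have hle : Finsupp.single j 1 ≤ m + Finsupp.single i 1 ↔ Finsupp.single j 1 ≤ m := by
    simp [Finsupp.single_le_iff, h.symm]
  by_cases hm : Finsupp.single j 1 ≤ m
  · rw [if_pos hm, if_pos (hle.mpr hm), tsub_add_eq_add_tsub hm]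
  · rw [if_neg hm, if_neg (mt hle.mp hm)]

theorem IsFree.mul {i : σ} {g h : MvPowerSeries σ k} (hg : IsFree i g) (hh : IsFree i h) :
    IsFree i (g * h) := fun f => by
  rw [mul_assoc, hg, hh, mul_assoc]

theorem IsFree.sub {i : σ} {g h : MvPowerSeries σ k} (hg : IsFree i g) (hh : IsFree i h) :
    IsFree i (g - h) := fun f => by
  rw [sub_mul, map_sub, hg, hh, sub_mul]

theorem IsFree.pow {i : σ} {g : MvPowerSeries σ k} (hg : IsFree i g) (n : ℕ) :
    IsFree i (g ^ n) := by
  induction n with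
  | zero => exact fun f => by simp
  | succ n ih => exact pow_succ g n ▸ ih.mul hg

/-- `X i` is a non-zero-divisor modulo two power series not involving `X i`. -/
theorem X_cancel_mod_pair {i : σ} {u v : MvPowerSeries σ k} (hu : IsFree i u) (hv : IsFree i v)
    (f a b : MvPowerSeries σ k) (h : X i * f = a * u + b * v) :
    ∃ a' b', f = a' * u + b' * v := by
  refine ⟨divX i a, divX i b, ?_⟩
  rw [← divX_X_mul i f, h, map_add, mul_comm a, mul_comm b, hu, hv, mul_comm u, mul_comm v]

/-- A nonzero power series not involving `X i`, `X j` is a non-zero-divisor modulo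
`(X i, X j)`. -/
theorem cancel_mod_X_X [IsDomain k] {i j : σ} (hij : i ≠ j) {c : MvPowerSeries σ k} (hc : c ≠ 0)
    (hi : IsFree i c) (hj : IsFree j c) (f a b : MvPowerSeries σ k)
    (h : c * f = a * X i + b * X j) : ∃ a' b', f = a' * X i + b' * X j := by
  have hDi : c * divX i f = a + X j * divX i b := by
    rw [← hi, h, map_add, mul_comm a, divX_X_mul, mul_comm b, isFree_X hij.symm]
  have hDj : c * divX j (f - X i * divX i f) = b - X i * divX i b := by
    rw [← hj, ← divX_X_mul j (b - X i * divX i b)]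
    congr 1
    linear_combination h - X i * hDi
  refine ⟨divX i f, divX j (f - X i * divX i f), mul_left_cancel₀ hc ?_⟩
  linear_combination h - X i * hDi - X j * hDj

end MvPowerSeries

section Minors

open MvPowerSeries

variable (k : Type) [Field k]

theorem G1_ne_zero : G1 k ≠ 0 := by
  intro h
  have h₁ : py k * pt k = pz k * ps k := sub_eq_zero.mp h
  have h₂ : pt k = pz k * divX 1 (ps k) := by
    rw [← divX_X_mul 1 (pt k)]
    exact (congrArg _ h₁).trans (isFree_X (by decide) _)
  have h₃ : (1 : MvPowerSeries (Fin 6) k) = pz k * divX 5 (divX 1 (ps k)) := by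
    rw [← divX_X_mul 5 (1 : MvPowerSeries (Fin 6) k), mul_one]
    exact (congrArg _ h₂).trans (isFree_X (by decide) _)
  simpa [pz] using congrArg constantCoeff h₃

theorem isFree_G1 {i : Fin 6} (h₁ : 1 ≠ i) (h₂ : 2 ≠ i) (h₄ : 4 ≠ i) (h₅ : 5 ≠ i) :
    IsFree i (G1 k) :=
  ((isFree_X h₁).mul (isFree_X h₅)).sub ((isFree_X h₂).mul (isFree_X h₄))

theorem Om32_eq : Om32 k = Ideal.span {G1 k, px k, pw k} := by
  have hx : px k ∈ Ideal.span {G1 k, px k, pw k} := Ideal.subset_span (by simp)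
  have hw : pw k ∈ Ideal.span {G1 k, px k, pw k} := Ideal.subset_span (by simp)
  refine le_antisymm (sup_le (Ideal.span_le.mpr ?_) (Ideal.span_mono (by simp)))
    (Ideal.span_le.mpr ?_)
  · rintro _ (rfl | rfl | rfl)
    · exact Ideal.subset_span (by simp)
    · exact sub_mem (Ideal.mul_mem_right _ _ hx) (Ideal.mul_mem_left _ _ hw)
    · exact sub_mem (Ideal.mul_mem_right _ _ hx) (Ideal.mul_mem_left _ _ hw)
  · rintro _ (rfl | rfl | rfl)
    · exact Ideal.mem_sup_left (Ideal.subset_span (by simp))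
    · exact Ideal.mem_sup_right (Ideal.subset_span (by simp))
    · exact Ideal.mem_sup_right (Ideal.subset_span (by simp))

end Minors

/-- `Ω^{[p]} : Ω = (G₁^p, x^p, w^p, (G₁xw)^{p-1})`, and this ideal equals
`Ω^{[p]} + ((G₃G₂)^{p-1})`; in particular the classes of `(G₁xw)^{p-1}` and `(G₃G₂)^{p-1}`
both generate the cyclic module `(Ω^{[p]} : Ω)/Ω^{[p]}`. -/
theorem stmt12 (p : ℕ) (hp : p.Prime) (k : Type) [Field k] [CharP k p] :
    Submodule.colon (frobPow p (Om32 k)) (Om32 k) =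
      Ideal.span {G1 k ^ p, px k ^ p, pw k ^ p, (G1 k * px k * pw k) ^ (p - 1)} ∧
    Submodule.colon (frobPow p (Om32 k)) (Om32 k) =
      frobPow p (Om32 k) ⊔ Ideal.span {(G3 k * G2 k) ^ (p - 1)} := by
  have hinj : Function.Injective (algebraMap k (MvPowerSeries (Fin 6) k)) :=
    (algebraMap k (MvPowerSeries (Fin 6) k)).injective
  have : CharP (MvPowerSeries (Fin 6) k) p := charP_of_injective_algebraMap hinj p
  have : IsDomain (MvPowerSeries (Fin 6) k) := NoZeroDivisors.to_isDomain _
  obtain ⟨n, rfl⟩ : ∃ n, p = n + 1 := Nat.exists_eq_succ_of_ne_zero hp.ne_zero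
  have hfrob := frobPow_span_triple hp (G1 k) (px k) (pw k)
  rw [← Om32_eq] at hfrob
  have hcolon : Submodule.colon (frobPow (n + 1) (Om32 k)) (Om32 k) =
      Ideal.span {G1 k ^ (n + 1), px k ^ (n + 1), pw k ^ (n + 1),
        (G1 k * px k * pw k) ^ n} := by
    rw [hfrob, Om32_eq, Ideal.colon_span]
    apply le_antisymm
    · intro r hr
      rw [Submodule.mem_colon] at hr
      refine mem_of_mul_mem_powers ?_ ?_ ?_ (hr _ (by simp)) (hr _ (by simp)) (hr _ (by simp))
      · exact MvPowerSeries.X_cancel_mod_pair ((MvPowerSeries.isFree_X (by decide)).pow _)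
          ((isFree_G1 k (by decide) (by decide) (by decide) (by decide)).pow _)
      · exact MvPowerSeries.X_cancel_mod_pair (MvPowerSeries.isFree_X (by decide))
          ((isFree_G1 k (by decide) (by decide) (by decide) (by decide)).pow _)
      · exact MvPowerSeries.cancel_mod_X_X (by decide) (G1_ne_zero k)
          (isFree_G1 k (by decide) (by decide) (by decide) (by decide))
          (isFree_G1 k (by decide) (by decide) (by decide) (by decide))
    · refine Ideal.span_le.mpr ?_
      rintro _ (rfl | rfl | rfl | rfl)
      · exact Ideal.le_colon (Ideal.subset_span (by simp))
      · exact Ideal.le_colon (Ideal.subset_span (by simp))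
      · exact Ideal.le_colon (Ideal.subset_span (by simp))
      · refine Submodule.mem_colon.mpr ?_
        rintro _ (rfl | rfl | rfl)
        · exact Ideal.mem_of_dvd _ ⟨(px k * pw k) ^ n, by rw [smul_eq_mul]; ring⟩
            (Ideal.subset_span (Set.mem_insert _ _))
        · exact Ideal.mem_of_dvd _ ⟨(G1 k * pw k) ^ n, by rw [smul_eq_mul]; ring⟩
            (Ideal.subset_span (Set.mem_insert_of_mem _ (Set.mem_insert _ _)))
        · exact Ideal.mem_of_dvd _ ⟨(G1 k * px k) ^ n, by rw [smul_eq_mul]; ring⟩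
            (Ideal.subset_span (Set.mem_insert_of_mem _ (Set.mem_insert_of_mem _ rfl)))
  refine ⟨hcolon, hcolon.trans ?_⟩
  have hdiff : (G3 k * G2 k) ^ n - (G1 k * px k * pw k) ^ n ∈
      Ideal.span {G1 k ^ (n + 1), px k ^ (n + 1), pw k ^ (n + 1)} :=
    Ideal.span_mono (Set.subset_insert _ _)
      (minors_pow_sub_mem hp (px k) (py k) (pz k) (pw k) (ps k) (pt k))
  rw [hfrob, Nat.add_sub_cancel]
  apply le_antisymm
  · refine Ideal.span_le.mpr ?_
    rintro _ (rfl | rfl | rfl | rfl)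
    · exact Ideal.mem_sup_left (Ideal.subset_span (by simp))
    · exact Ideal.mem_sup_left (Ideal.subset_span (by simp))
    · exact Ideal.mem_sup_left (Ideal.subset_span (by simp))
    · rw [← sub_sub_cancel ((G3 k * G2 k) ^ n) ((G1 k * px k * pw k) ^ n)]
      exact sub_mem (Ideal.mem_sup_right (Ideal.mem_span_singleton_self _))
        (Ideal.mem_sup_left hdiff)
  · have hle : Ideal.span {G1 k ^ (n + 1), px k ^ (n + 1), pw k ^ (n + 1)} ≤
        Ideal.span {G1 k ^ (n + 1), px k ^ (n + 1), pw k ^ (n + 1),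
          (G1 k * px k * pw k) ^ n} :=
      Ideal.span_mono (by rintro _ (rfl | rfl | rfl) <;> simp)
    refine sup_le hle ((Ideal.span_singleton_le_iff_mem _).mpr ?_)
    rw [← sub_add_cancel ((G3 k * G2 k) ^ n) ((G1 k * px k * pw k) ^ n)]
    exact add_mem (hle hdiff) (Ideal.subset_span (by simp))
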